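/- Let μ ≥ 1 (μ = ∞ allowed) and let V(η, ξ; x) be a ℂ^N-valued map of class C^μ on a neighborhood of 0 in ℂ^h × ℂ^N × ℝ^m, holomorphic in (η, ξ) for each fixed x. Suppose V(η, 0; x) ≡ 0 and that for each fixed x the function δ(η; x) := (det(∂V/∂ξ)(η, 0; x))² does not vanish identically in η. Then there exists a ℂ^N-valued map φ(η, Z̃; x) on a neighborhood of 0 in ℂ^h × ℂ^N × ℝ^m, of class C^μ and holomorphic in (η, Z̃) for each fixed x, such that the identity V(η, φ(η, Z/δ(η; x); x); x) = Z holds for all (η, Z, x) with (η; x) sufficiently small, δ(η; x) ≠ 0, and Z/δ(η; x) sufficiently small. -/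

import Mathlib

open Topology

theorem hasFDerivAt_intervalIntegral_of_continuousOn {𝕜 H E : Type*} [RCLike 𝕜]
    [NormedAddCommGroup H] [NormedSpace 𝕜 H] [NormedAddCommGroup E] [NormedSpace ℝ E]
    [NormedSpace 𝕜 E] {f : H → ℝ → E} {f' : H → ℝ → H →L[𝕜] E} {O : Set H} (hO : IsOpen O)
    (hf : ∀ p ∈ O, ∀ s, HasFDerivAt (f · s) (f' p s) p)
    (hfc : ∀ p ∈ O, Continuous (f p))
    (hf'c : ContinuousOn (fun y : H × ℝ => f' y.1 y.2) (O ×ˢ Set.univ))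
    (a b : ℝ) {p : H} (hp : p ∈ O) :
    HasFDerivAt (fun p => ∫ s in a..b, f p s) (∫ s in a..b, f' p s) p := by
  have hf'p : ∀ p ∈ O, Continuous (f' p) := fun p hp =>
    hf'c.comp_continuous (f := fun s : ℝ => (p, s)) (by fun_prop) fun s => ⟨hp, trivial⟩
  obtain ⟨C, hC⟩ := (isCompact_uIcc (a := a) (b := b)).exists_bound_of_continuousOn
    (hf'p p hp).continuousOn
  have hn : IsOpen ((O ×ˢ Set.univ) ∩ (fun y : H × ℝ => ‖f' y.1 y.2‖) ⁻¹' Set.Iio (C + 1)) :=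
    hf'c.norm.isOpen_inter_preimage (hO.prod isOpen_univ) isOpen_Iio
  obtain ⟨u, v, hu, -, hpu, hv, huv⟩ := generalized_tube_lemma (isCompact_singleton (x := p))
    (isCompact_uIcc (a := a) (b := b)) hn (by
      rintro ⟨q, s⟩ ⟨rfl, hs⟩
      exact ⟨⟨hp, trivial⟩, (hC s hs).trans_lt (lt_add_one C)⟩)
  refine intervalIntegral.hasFDerivAt_integral_of_dominated_of_fderiv_le (F' := f')
    (bound := fun _ => C + 1)
    (Filter.inter_mem (hO.mem_nhds hp) (hu.mem_nhds (hpu rfl))) ?_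
    ((hfc p hp).intervalIntegrable _ _) (hf'p p hp).aestronglyMeasurable ?_
    intervalIntegrable_const (.of_forall fun s _ q hq => hf q hq.1 s)
  · filter_upwards [hO.mem_nhds hp] with q hq using (hfc q hq).aestronglyMeasurable
  · exact .of_forall fun s hs q hq =>
      (huv (Set.mk_mem_prod hq.2 (hv (Set.uIoc_subset_uIcc hs)))).2.le

theorem continuousOn_intervalIntegral_of_continuousOn {P E : Type*} [NormedAddCommGroup P]
    [NormedAddCommGroup E] [NormedSpace ℝ E] {f : P × ℝ → E} {O : Set P}
    (hf : ContinuousOn f (O ×ˢ Set.univ)) (a b : ℝ) :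
    ContinuousOn (fun p => ∫ s in a..b, f (p, s)) O := by
  rw [continuousOn_iff_continuous_domRestrict]
  exact intervalIntegral.continuous_parametric_intervalIntegral_of_continuous'
    (f := fun (p : O) s => f (p, s))
    (hf.comp_continuous (f := fun y : O × ℝ => ((y.1 : P), y.2)) (by fun_prop)
      fun y => ⟨y.1.2, trivial⟩) a b

section

variable {P : Type*} [NormedAddCommGroup P] [NormedSpace ℝ P] {O : Set P}

theorem hasFDerivAt_intervalIntegral_of_contDiffOn {E : Type*} [NormedAddCommGroup E]
    [NormedSpace ℝ E] {f : P × ℝ → E} (hO : IsOpen O) (hf : ContDiffOn ℝ 1 f (O ×ˢ Set.univ))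
    (a b : ℝ) {p : P} (hp : p ∈ O) :
    HasFDerivAt (fun p => ∫ s in a..b, f (p, s))
      (∫ s in a..b, (fderiv ℝ f (p, s)).comp (.inl ℝ P ℝ)) p := by
  have hO' : IsOpen (O ×ˢ (Set.univ : Set ℝ)) := hO.prod isOpen_univ
  refine hasFDerivAt_intervalIntegral_of_continuousOn (f := fun p s => f (p, s))
    (f' := fun p s => (fderiv ℝ f (p, s)).comp (.inl ℝ P ℝ)) hO ?_ ?_ ?_ a b hp
  · intro q hq s
    have h1 : HasFDerivAt f (fderiv ℝ f (q, s)) (q, s) :=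
      ((hf.differentiableOn one_ne_zero).differentiableAt
        (hO'.mem_nhds ⟨hq, trivial⟩)).hasFDerivAt
    exact h1.comp q (hasFDerivAt_prodMk_left q s)
  · intro q hq
    exact hf.continuousOn.comp_continuous (f := fun s : ℝ => (q, s)) (by fun_prop)
      fun s => ⟨hq, trivial⟩
  · exact (hf.continuousOn_fderiv_of_isOpen hO' le_rfl).clm_comp continuousOn_const

end

universe u

theorem ContDiffOn.intervalIntegral_nat {P : Type u} [NormedAddCommGroup P] [NormedSpace ℝ P]
    {O : Set P} (hO : IsOpen O) (n : ℕ) :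
    ∀ {E : Type u} [NormedAddCommGroup E] [NormedSpace ℝ E] {f : P × ℝ → E}
      (_ : ContDiffOn ℝ n f (O ×ˢ Set.univ)) (a b : ℝ),
      ContDiffOn ℝ n (fun p => ∫ s in a..b, f (p, s)) O := by
  have hO' : IsOpen (O ×ˢ (Set.univ : Set ℝ)) := hO.prod isOpen_univ
  induction n with
  | zero =>
    intro E _ _ f hf a b
    rw [Nat.cast_zero, contDiffOn_zero] at hf ⊢
    exact continuousOn_intervalIntegral_of_continuousOn hf a b
  | succ n ih =>
    intro E _ _ f hf a b
    have h1 : ContDiffOn ℝ 1 f (O ×ˢ Set.univ) := hf.of_le (by simp)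
    rw [Nat.cast_succ] at hf ⊢
    rw [contDiffOn_succ_iff_fderiv_of_isOpen hO]
    refine ⟨fun p hp => (hasFDerivAt_intervalIntegral_of_contDiffOn hO h1 a b
      hp).differentiableAt.differentiableWithinAt, by simp, ?_⟩
    rw [contDiffOn_succ_iff_fderiv_of_isOpen hO'] at hf
    refine ContDiffOn.congr (f := fun p => ∫ s in a..b, (fderiv ℝ f (p, s)).comp (.inl ℝ P ℝ))
      ?_ fun p hp => (hasFDerivAt_intervalIntegral_of_contDiffOn hO h1 a b hp).fderiv
    exact ih (f := fun y => (fderiv ℝ f y).comp (.inl ℝ P ℝ)) (hf.2.2.clm_comp contDiffOn_const) a b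

theorem ContDiffOn.intervalIntegral {P E : Type u} [NormedAddCommGroup P] [NormedSpace ℝ P]
    [NormedAddCommGroup E] [NormedSpace ℝ E] {O : Set P} (hO : IsOpen O) {n : ℕ∞}
    {f : P × ℝ → E} (hf : ContDiffOn ℝ n f (O ×ˢ Set.univ)) (a b : ℝ) :
    ContDiffOn ℝ n (fun p => ∫ s in a..b, f (p, s)) O := by
  rw [contDiffOn_iff_forall_nat_le] at hf ⊢
  exact fun k hk => .intervalIntegral_nat hO k (hf k hk) a b

/-- `f (q, x)` is `C^μ` in all variables jointly on `O`, and holomorphic in `q` for fixed `x`. -/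
def ContDiffHolOn {Q X E : Type*} [NormedAddCommGroup Q] [NormedSpace ℂ Q]
    [NormedAddCommGroup X] [NormedSpace ℝ X] [NormedAddCommGroup E] [NormedSpace ℂ E]
    (μ : ℕ∞) (f : Q × X → E) (O : Set (Q × X)) : Prop :=
  ContDiffOn ℝ μ f O ∧ ∀ x, DifferentiableOn ℂ (fun q => f (q, x)) {q | (q, x) ∈ O}

namespace ContDiffHolOn

variable {Q X E F : Type*} [NormedAddCommGroup Q] [NormedSpace ℂ Q]
  [NormedAddCommGroup X] [NormedSpace ℝ X] [NormedAddCommGroup E] [NormedSpace ℂ E]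
  [NormedAddCommGroup F] [NormedSpace ℂ F]
  {μ : ℕ∞} {f : Q × X → E} {O : Set (Q × X)}

theorem mono {O' : Set (Q × X)} (hf : ContDiffHolOn μ f O) (h : O' ⊆ O) :
    ContDiffHolOn μ f O' :=
  ⟨hf.1.mono h, fun x => (hf.2 x).mono fun _ hq => h hq⟩

theorem congr {g : Q × X → E} (hf : ContDiffHolOn μ f O) (h : ∀ p ∈ O, g p = f p) :
    ContDiffHolOn μ g O :=
  ⟨hf.1.congr h, fun x => (hf.2 x).congr fun _ hq => h _ hq⟩

theorem prodMk {g : Q × X → F} (hf : ContDiffHolOn μ f O) (hg : ContDiffHolOn μ g O) :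
    ContDiffHolOn μ (fun p => (f p, g p)) O :=
  ⟨hf.1.prodMk hg.1, fun x => (hf.2 x).prodMk (hg.2 x)⟩

theorem contDiff_comp {g : E → F} (hg : ContDiff ℂ μ g) (hμ : 1 ≤ μ) (hf : ContDiffHolOn μ f O) :
    ContDiffHolOn μ (fun p => g (f p)) O :=
  ⟨(hg.restrict_scalars ℝ).comp_contDiffOn hf.1, fun x =>
    (hg.differentiable (by rintro h; norm_cast at h; simp [h] at hμ)).comp_differentiableOn
      (hf.2 x)⟩

theorem comp {Q' : Type*} [NormedAddCommGroup Q'] [NormedSpace ℂ Q'] {O' : Set (Q' × X)}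
    {g : Q' × X → Q} (hf : ContDiffHolOn μ f O) (hg : ContDiffHolOn μ g O')
    (h : ∀ p ∈ O', (g p, p.2) ∈ O) : ContDiffHolOn μ (fun p => f (g p, p.2)) O' :=
  ⟨hf.1.comp (hg.1.prodMk contDiffOn_snd) h, fun x => (hf.2 x).comp (hg.2 x) fun _ hq => h _ hq⟩

theorem contDiff_fst {g : Q → E} (hg : ContDiff ℂ μ g) (hμ : 1 ≤ μ) :
    ContDiffHolOn μ (fun p : Q × X => g p.1) O :=
  contDiff_comp hg hμ ⟨contDiffOn_fst, fun _ => differentiableOn_id⟩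

theorem comp_contDiff_fst {Q' : Type*} [NormedAddCommGroup Q'] [NormedSpace ℂ Q']
    {O' : Set (Q' × X)} {g : Q' → Q} (hf : ContDiffHolOn μ f O) (hμ : 1 ≤ μ)
    (hg : ContDiff ℂ μ g) (h : ∀ p ∈ O', (g p.1, p.2) ∈ O) :
    ContDiffHolOn μ (fun p => f (g p.1, p.2)) O' :=
  hf.comp (contDiff_fst hg hμ) h

theorem smul {c : Q × X → ℂ} (hc : ContDiffHolOn μ c O) (hf : ContDiffHolOn μ f O) :
    ContDiffHolOn μ (fun p => c p • f p) O :=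
  ⟨hc.1.smul hf.1, fun x => (hc.2 x).smul (hf.2 x)⟩

theorem sub {g : Q × X → E} (hf : ContDiffHolOn μ f O) (hg : ContDiffHolOn μ g O) :
    ContDiffHolOn μ (fun p => f p - g p) O :=
  ⟨hf.1.sub hg.1, fun x => (hf.2 x).sub (hg.2 x)⟩

theorem add {g : Q × X → E} (hf : ContDiffHolOn μ f O) (hg : ContDiffHolOn μ g O) :
    ContDiffHolOn μ (fun p => f p + g p) O :=
  ⟨hf.1.add hg.1, fun x => (hf.2 x).add (hg.2 x)⟩

theorem inv {c : Q × X → ℂ} (hc : ContDiffHolOn μ c O) (h : ∀ p ∈ O, c p ≠ 0) :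
    ContDiffHolOn μ (fun p => (c p)⁻¹) O :=
  ⟨hc.1.inv h, fun x => (hc.2 x).fun_inv fun _ hq => h _ hq⟩

theorem pi {ι : Type*} [Fintype ι] {E : ι → Type*} [∀ i, NormedAddCommGroup (E i)]
    [∀ i, NormedSpace ℂ (E i)] {f : Q × X → ∀ i, E i}
    (hf : ∀ i, ContDiffHolOn μ (fun p => f p i) O) : ContDiffHolOn μ f O :=
  ⟨contDiffOn_pi.2 fun i => (hf i).1, fun x => differentiableOn_pi.2 fun i => (hf i).2 x⟩

end ContDiffHolOn

theorem ContDiffHolOn.intervalIntegral {Q X E : Type u} [NormedAddCommGroup Q] [NormedSpace ℂ Q]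
    [NormedAddCommGroup X] [NormedSpace ℝ X] [NormedAddCommGroup E] [NormedSpace ℂ E]
    {μ : ℕ∞} (hμ : 1 ≤ μ) {O : Set (Q × X)} (hO : IsOpen O) {f : (Q × X) × ℝ → E}
    (hf : ContDiffOn ℝ μ f (O ×ˢ Set.univ))
    (hfs : ∀ s x, DifferentiableOn ℂ (fun q => f ((q, x), s)) {q | (q, x) ∈ O}) (a b : ℝ) :
    ContDiffHolOn μ (fun p => ∫ s in a..b, f (p, s)) O := by
  refine ⟨hf.intervalIntegral hO a b, fun x => ?_⟩
  have hO' : IsOpen (O ×ˢ (Set.univ : Set ℝ)) := hO.prod isOpen_univ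
  have h1 : ContDiffOn ℝ 1 f (O ×ˢ Set.univ) := hf.of_le (by exact_mod_cast hμ)
  have hOx : IsOpen {q | (q, x) ∈ O} := hO.preimage (by fun_prop)
  have hd : ∀ q, (q, x) ∈ O → ∀ s, HasFDerivAt (fun q => f ((q, x), s))
      (fderiv ℂ (fun q => f ((q, x), s)) q) q := fun q hq s =>
    ((hfs s x).differentiableAt (hOx.mem_nhds hq)).hasFDerivAt
  intro q hq
  refine (hasFDerivAt_intervalIntegral_of_continuousOn (f := fun q s => f ((q, x), s))
    (f' := fun q s => fderiv ℂ (fun q => f ((q, x), s)) q) hOx hd ?_ ?_ a b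
    hq).differentiableAt.differentiableWithinAt
  · intro q hq
    exact hf.continuousOn.comp_continuous (f := fun s : ℝ => ((q, x), s)) (by fun_prop)
      fun s => ⟨hq, trivial⟩
  · rw [(ContinuousLinearMap.isUniformEmbedding_restrictScalars
      ℝ).isInducing.continuousOn_iff]
    have hc : ContinuousOn (fun y : Q × ℝ => fderiv ℝ f ((y.1, x), y.2))
        ({q | (q, x) ∈ O} ×ˢ Set.univ) :=
      (h1.continuousOn_fderiv_of_isOpen hO' le_rfl).comp
        (f := fun y : Q × ℝ => ((y.1, x), y.2)) (by fun_prop) fun y hy => ⟨hy.1, trivial⟩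
    refine (hc.clm_comp (continuousOn_const
      (c := (ContinuousLinearMap.inl ℝ (Q × X) ℝ).comp (.inl ℝ Q X)))).congr ?_
    rintro ⟨q, s⟩ ⟨hq, -⟩
    have h2 : HasFDerivAt f (fderiv ℝ f ((q, x), s)) ((q, x), s) :=
      ((h1.differentiableOn one_ne_zero).differentiableAt
        (hO'.mem_nhds (Set.mk_mem_prod (show (q, x) ∈ O from hq) trivial))).hasFDerivAt
    exact ((hd q hq s).restrictScalars ℝ).unique <| h2.comp (f := fun q => ((q, x), s)) q <|
      HasFDerivAt.comp (g := fun p : Q × X => (p, s)) (f := fun q : Q => (q, x)) q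
        (hasFDerivAt_prodMk_left (q, x) s) (hasFDerivAt_prodMk_left q x)

theorem ContDiffHolOn.exists_local_inverse {Q X : Type*} [NormedAddCommGroup Q] [NormedSpace ℂ Q]
    [FiniteDimensional ℂ Q] [NormedAddCommGroup X] [NormedSpace ℝ X] [CompleteSpace X]
    {μ : ℕ∞} (hμ : 1 ≤ μ) {O : Set (Q × X)} (hO : IsOpen O) {Ψ : Q × X → Q}
    (hΨ : ContDiffHolOn μ Ψ O) {p₀ : Q × X} (hp₀ : p₀ ∈ O)
    (hd : HasFDerivAt Ψ (ContinuousLinearMap.fst ℝ Q X) p₀) :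
    ∃ W : Set (Q × X), IsOpen W ∧ (Ψ p₀, p₀.2) ∈ W ∧ ∃ S : Q × X → Q, ContDiffHolOn μ S W ∧
      ∀ p ∈ W, (S p, p.2) ∈ O ∧ Ψ (S p, p.2) = p.1 := by
  have : CompleteSpace Q := FiniteDimensional.complete ℂ Q
  have hμ' : (1 : WithTop ℕ∞) ≤ μ := by exact_mod_cast hμ
  have hμ0 : (μ : WithTop ℕ∞) ≠ 0 := fun h => by simp [h] at hμ'
  set G : Q × X → Q × X := fun p => (Ψ p, p.2)
  have hG : ContDiffOn ℝ μ G O := hΨ.1.prodMk contDiffOn_snd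
  have hGd : HasFDerivAt G ((ContinuousLinearEquiv.refl ℝ (Q × X) : (Q × X) ≃L[ℝ] (Q × X)) :
      (Q × X) →L[ℝ] (Q × X)) p₀ := hd.prodMk hasFDerivAt_snd
  have hG₀ : ContDiffAt ℝ μ G p₀ := hG.contDiffAt (hO.mem_nhds hp₀)
  set e := hG₀.toOpenPartialHomeomorph G hGd hμ0
  have heG : ∀ p, e p = G p := fun _ => rfl
  set O' : Set (Q × X) := O ∩ fderiv ℝ G ⁻¹'
    Set.range ((↑) : ((Q × X) ≃L[ℝ] (Q × X)) → (Q × X) →L[ℝ] (Q × X))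
  have hO' : IsOpen O' := (hG.continuousOn_fderiv_of_isOpen hO hμ').isOpen_inter_preimage hO
    (ContinuousLinearEquiv.isOpen)
  have hp₀' : p₀ ∈ O' := ⟨hp₀, ⟨_, hGd.fderiv.symm⟩⟩
  have hp₀e : p₀ ∈ e.source := hG₀.mem_toOpenPartialHomeomorph_source hGd hμ0
  have hWo : IsOpen (e.target ∩ e.symm ⁻¹' O') := e.symm.isOpen_inter_preimage hO'
  have hsnd : ∀ p ∈ e.target, e.symm p = ((e.symm p).1, p.2) := fun p hp => by
    have h1 : G (e.symm p) = p := (heG _).symm.trans (e.right_inv hp)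
    have h2 := congrArg Prod.snd h1
    exact Prod.ext rfl h2
  have hinv : ∀ p ∈ e.target, Ψ ((e.symm p).1, p.2) = p.1 := fun p hp => by
    rw [← hsnd p hp]
    exact congrArg (fun y : Q × X => y.1) ((heG _).symm.trans (e.right_inv hp))
  refine ⟨e.target ∩ e.symm ⁻¹' O', hWo,
    ⟨e.map_source hp₀e, ?_⟩, fun p => (e.symm p).1, ⟨?_, ?_⟩, ?_⟩
  · change e.symm (e p₀) ∈ O'
    rwa [e.left_inv hp₀e]
  · rintro p ⟨hp, hpO, A, hA⟩
    have h1 := hG.contDiffAt (hO.mem_nhds hpO)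
    have h2 : HasFDerivAt G (A : (Q × X) →L[ℝ] (Q × X)) (e.symm p) := by
      rw [hA]
      exact (h1.differentiableAt hμ0).hasFDerivAt
    exact (_root_.contDiff_fst.contDiffAt.comp p (e.contDiffAt_symm hp h2 h1)).contDiffWithinAt
  · rintro x q ⟨hp, hpO, A, hA⟩
    have hpO' : ((e.symm (q, x)).1, x) ∈ O := by
      have := hsnd _ hp
      exact this ▸ hpO
    have h3 := ((hΨ.2 x).differentiableAt ((hO.preimage (by fun_prop : Continuous
      fun q : Q => (q, x))).mem_nhds hpO')).hasFDerivAt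
    have h1 := ((hG.contDiffAt (hO.mem_nhds hpO)).differentiableAt hμ0).hasFDerivAt
    rw [← hA, hsnd _ hp] at h1
    set M := fderiv ℂ (fun q => Ψ (q, x)) (e.symm (q, x)).1
    have hM : ∀ v, A (v, 0) = (M v, 0) := by
      intro v
      have h4 := (h1.comp (f := fun q => (q, x)) _
        (hasFDerivAt_prodMk_left (e.symm (q, x)).1 x)).unique
        ((h3.restrictScalars ℝ).prodMk (hasFDerivAt_const x (e.symm (q, x)).1))
      exact DFunLike.congr_fun h4 v
    have hinj : Function.Injective M.toLinearMap := by
      intro v w hvw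
      have : A (v, 0) = A (w, 0) := by
        rw [hM, hM]
        exact congrArg (·, _) hvw
      exact congrArg Prod.fst (A.injective this)
    let M' : Q ≃L[ℂ] Q := (LinearEquiv.ofInjectiveEndo M.toLinearMap hinj).toContinuousLinearEquiv
    have hM' : (M' : Q →L[ℂ] Q) = M := by
      ext v
      rfl
    have hx : ContinuousAt (fun q : Q => (q, x)) q := by fun_prop
    refine (HasFDerivAt.of_local_left_inverse (f := fun q => Ψ (q, x)) (f' := M')
      (g := fun q => (e.symm (q, x)).1) ?_ (hM' ▸ h3) ?_).differentiableAt.differentiableWithinAt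
    · exact continuousAt_fst.comp (ContinuousAt.comp (f := fun q : Q => (q, x))
        (e.symm.continuousAt hp) hx)
    · filter_upwards [hx.preimage_mem_nhds (e.open_target.mem_nhds hp)] with q hq using hinv _ hq
  · rintro p ⟨hp, hpO⟩
    exact ⟨hsnd p hp ▸ hpO.1, hinv p hp⟩

section CircleIntegral

variable {Q X E : Type u} [NormedAddCommGroup Q] [NormedSpace ℂ Q]
  [NormedAddCommGroup X] [NormedSpace ℝ X] [NormedAddCommGroup E] [NormedSpace ℂ E]
  {μ : ℕ∞} {O : Set (Q × X)} {Ω : Set ((ℂ × Q) × X)} {f : (ℂ × Q) × X → E} {r : ℝ}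

theorem ContDiffHolOn.contDiffOn_circleMap (hf : ContDiffHolOn μ f Ω)
    (hΩ : ∀ p ∈ O, ∀ θ, ((circleMap 0 r θ, p.1), p.2) ∈ Ω) :
    ContDiffOn ℝ μ (fun y : (Q × X) × ℝ => deriv (circleMap 0 r) y.2 •
      f ((circleMap 0 r y.2, y.1.1), y.1.2)) (O ×ˢ Set.univ) := by
  have hc : ContDiff ℝ μ (circleMap 0 r) := contDiff_circleMap 0 r
  have h1 : ContDiffOn ℝ μ (fun y : (Q × X) × ℝ => f ((circleMap 0 r y.2, y.1.1), y.1.2))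
      (O ×ˢ Set.univ) :=
    hf.1.comp (f := fun y : (Q × X) × ℝ => ((circleMap 0 r y.2, y.1.1), y.1.2))
      (ContDiff.contDiffOn (by fun_prop)) fun y hy => hΩ _ hy.1 _
  refine ContDiffOn.smul (ContDiff.contDiffOn ?_) h1
  simp only [deriv_circleMap]
  fun_prop

theorem ContDiffHolOn.circleIntegral (hμ : 1 ≤ μ) (hO : IsOpen O) (hf : ContDiffHolOn μ f Ω)
    (hΩ : ∀ p ∈ O, ∀ θ, ((circleMap 0 r θ, p.1), p.2) ∈ Ω) :
    ContDiffHolOn μ (fun p => ∮ s in C(0, r), f ((s, p.1), p.2)) O := by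
  refine ContDiffHolOn.intervalIntegral hμ hO (hf.contDiffOn_circleMap hΩ) ?_ _ _
  intro θ x
  have h : DifferentiableOn ℂ (fun q => f ((circleMap 0 r θ, q), x)) {q | (q, x) ∈ O} :=
    (hf.2 x).comp (f := fun q => (circleMap 0 r θ, q)) (by fun_prop) fun q hq => hΩ (q, x) hq θ
  exact h.const_smul (deriv (circleMap 0 r) θ)

theorem ContDiffHolOn.hasFDerivAt_circleIntegral_zero (hμ : 1 ≤ μ) (hO : IsOpen O)
    (hf : ContDiffHolOn μ f Ω) (hΩ : ∀ p ∈ O, ∀ θ, ((circleMap 0 r θ, p.1), p.2) ∈ Ω)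
    {p : Q × X} (hp : p ∈ O) (h0 : ∀ θ, HasFDerivAt (𝕜 := ℝ)
      (fun p : Q × X => f ((circleMap 0 r θ, p.1), p.2)) 0 p) :
    HasFDerivAt (𝕜 := ℝ) (fun p : Q × X => ∮ s in C(0, r), f ((s, p.1), p.2)) 0 p := by
  have hO' : IsOpen (O ×ˢ (Set.univ : Set ℝ)) := hO.prod isOpen_univ
  have h1 := (hf.contDiffOn_circleMap hΩ).of_le (m := 1) (by exact_mod_cast hμ)
  have h2 := hasFDerivAt_intervalIntegral_of_contDiffOn hO h1 0 (2 * Real.pi) hp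
  convert! h2 using 1
  symm
  refine (intervalIntegral.integral_congr (g := fun _ => 0) fun θ _ => ?_).trans (by simp)
  have h3 := ((h1.differentiableOn one_ne_zero).differentiableAt
    (hO'.mem_nhds (Set.mk_mem_prod hp (Set.mem_univ θ)))).hasFDerivAt.comp (f := fun p => (p, θ)) p
      (hasFDerivAt_prodMk_left p θ)
  have h4 := (h0 θ).const_smul (deriv (circleMap 0 r) θ)
  rw [smul_zero] at h4
  exact h3.unique h4

end CircleIntegral

theorem mem_ball_zero_prod {H X : Type*} [SeminormedAddCommGroup H] [SeminormedAddCommGroup X]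
    {η : H} {x : X} {ρ : ℝ} : (η, x) ∈ Metric.ball (0 : H × X) ρ ↔ ‖η‖ < ρ ∧ ‖x‖ < ρ := by
  simp [Prod.norm_def]

theorem mem_ball_zero_prod_prod {H Ξ X : Type*} [SeminormedAddCommGroup H]
    [SeminormedAddCommGroup Ξ] [SeminormedAddCommGroup X] {η : H} {ξ : Ξ} {x : X} {ρ : ℝ} :
    ((η, ξ), x) ∈ Metric.ball (0 : (H × Ξ) × X) ρ ↔ (‖η‖ < ρ ∧ ‖ξ‖ < ρ) ∧ ‖x‖ < ρ := by
  simp [Prod.norm_def]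

section Remainder

variable {H Ξ X E : Type} [NormedAddCommGroup H] [NormedSpace ℂ H]
  [NormedAddCommGroup Ξ] [NormedSpace ℂ Ξ]
  [NormedAddCommGroup X] [NormedSpace ℝ X] [NormedAddCommGroup E] [NormedSpace ℂ E]
  {μ : ℕ∞} {v : (H × Ξ) × X → E} {ρ : ℝ}

theorem ContDiffHolOn.differentiableOn_snd (hv : ContDiffHolOn μ v (Metric.ball 0 ρ))
    {η : H} {x : X} (hη : ‖η‖ < ρ) (hx : ‖x‖ < ρ) :
    DifferentiableOn ℂ (fun ξ => v ((η, ξ), x)) (Metric.ball 0 ρ) :=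
  (hv.2 x).comp (f := fun ξ => (η, ξ)) (by fun_prop) fun ξ hξ =>
    mem_ball_zero_prod_prod.2 ⟨⟨hη, mem_ball_zero_iff.1 hξ⟩, hx⟩

theorem ContDiffHolOn.hasFDerivAt_snd (hv : ContDiffHolOn μ v (Metric.ball 0 ρ))
    {η : H} {x : X} (hη : ‖η‖ < ρ) (hx : ‖x‖ < ρ) :
    HasFDerivAt (fun ξ => v ((η, ξ), x)) (fderiv ℂ (fun ξ => v ((η, ξ), x)) 0) 0 :=
  ((hv.differentiableOn_snd hη hx).differentiableAt
    (Metric.ball_mem_nhds 0 ((norm_nonneg _).trans_lt hη))).hasFDerivAt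

theorem ContDiffHolOn.hasDerivAt_smul (hv : ContDiffHolOn μ v (Metric.ball 0 ρ))
    {η : H} {x : X} (hη : ‖η‖ < ρ) (hx : ‖x‖ < ρ) (u : Ξ) :
    HasDerivAt (fun s : ℂ => v ((η, s • u), x)) (fderiv ℂ (fun ξ => v ((η, ξ), x)) 0 u) 0 := by
  have h1 : HasDerivAt (fun s : ℂ => s • u) u 0 := by
    simpa using (hasDerivAt_id (0 : ℂ)).smul_const u
  have h2 := hv.hasFDerivAt_snd hη hx
  rw [← zero_smul ℂ u] at h2
  have h3 := h2.comp_hasDerivAt (f := fun s : ℂ => s • u) (0 : ℂ) h1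
  rw [zero_smul] at h3
  exact h3

theorem ContDiffHolOn.fderiv_snd_apply [CompleteSpace E] (hμ : 1 ≤ μ)
    (hv : ContDiffHolOn μ v (Metric.ball 0 ρ)) (u : Ξ) :
    ContDiffHolOn μ (fun p : H × X => fderiv ℂ (fun ξ => v ((p.1, ξ), p.2)) 0 u)
      (Metric.ball 0 ρ) := by
  rcases le_or_gt ρ 0 with hρ | hρ
  · rw [Metric.ball_eq_empty.2 hρ]
    exact ⟨contDiffOn_empty, fun x => differentiableOn_empty⟩
  set R : ℝ := ρ / (‖u‖ + 1)
  have hu : 0 < ‖u‖ + 1 := by positivity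
  have hR : 0 < R := by positivity
  have hRu : ∀ s : ℂ, ‖s‖ ≤ R → ‖s • u‖ < ρ := fun s hs => by
    rw [norm_smul]
    calc ‖s‖ * ‖u‖ ≤ R * ‖u‖ := by gcongr
      _ < R * (‖u‖ + 1) := by gcongr; linarith
      _ = ρ := div_mul_cancel₀ _ hu.ne'
  have hΩ : ContDiffHolOn μ (fun p : (ℂ × H) × X => (p.1.1 ^ 2)⁻¹ • v ((p.1.2, p.1.1 • u), p.2))
      {p | p.1.1 ≠ 0 ∧ ((p.1.2, p.1.1 • u), p.2) ∈ Metric.ball (0 : (H × Ξ) × X) ρ} := by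
    refine ContDiffHolOn.smul (ContDiffHolOn.inv (ContDiffHolOn.contDiff_fst
      (g := fun q : ℂ × H => q.1 ^ 2) (by fun_prop) hμ) fun p hp => pow_ne_zero 2 hp.1) ?_
    exact hv.comp_contDiff_fst (g := fun q : ℂ × H => (q.2, q.1 • u)) hμ (by fun_prop)
      fun p hp => hp.2
  have hI := hΩ.circleIntegral (O := Metric.ball (0 : H × X) ρ) (r := R) hμ Metric.isOpen_ball (by
    rintro ⟨η, x⟩ hp θ
    rw [mem_ball_zero_prod] at hp
    refine ⟨circleMap_ne_center hR.ne', mem_ball_zero_prod_prod.2 ⟨⟨hp.1, hRu _ ?_⟩, hp.2⟩⟩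
    simp [abs_of_pos hR])
  refine ((ContDiffHolOn.contDiff_fst (g := fun _ => (2 * Real.pi * Complex.I : ℂ)⁻¹)
    contDiff_const hμ).smul hI).congr ?_
  rintro ⟨η, x⟩ hp
  rw [mem_ball_zero_prod] at hp
  have h1 : DifferentiableOn ℂ (fun s : ℂ => v ((η, s • u), x)) (Metric.closedBall 0 R) :=
    (hv.differentiableOn_snd hp.1 hp.2).comp (f := fun s : ℂ => s • u) (by fun_prop)
      fun s hs => mem_ball_zero_iff.2 (hRu s (mem_closedBall_zero_iff.1 hs))
  have h2 := h1.deriv_eq_smul_circleIntegral hR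
  rw [(hv.hasDerivAt_smul hp.1 hp.2 u).deriv] at h2
  simp only [sub_zero, one_div] at h2
  change _ = (2 * Real.pi * Complex.I : ℂ)⁻¹ • ∮ s in C(0, R), (s ^ 2)⁻¹ • v ((η, s • u), x)
  rw [h2, inv_smul_smul₀ Complex.two_pi_I_ne_zero]

/-- Taylor expansion to second order along `t ↦ t • u`, with a remainder that depends regularly
on all variables. -/
theorem ContDiffHolOn.exists_remainder [CompleteSpace E] (hμ : 1 ≤ μ)
    (hv : ContDiffHolOn μ v (Metric.ball 0 ρ))
    (hv0 : ∀ η x, ‖η‖ < ρ → ‖x‖ < ρ → v ((η, 0), x) = 0)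
    (hL : ContDiffHolOn μ
      (fun p : (H × Ξ) × X => fderiv ℂ (fun ξ => v ((p.1.1, ξ), p.2)) 0 p.1.2)
      {p | ‖p.1.1‖ < ρ ∧ ‖p.2‖ < ρ}) {r : ℝ} (hr : 0 < r) :
    ∃ R : (ℂ × H × Ξ) × X → E,
      ContDiffHolOn μ R {p | ‖p.1.1‖ < r ∧ ‖p.1.2.1‖ < ρ ∧ ‖p.1.2.2‖ < ρ / r ∧ ‖p.2‖ < ρ} ∧
      (∀ t η x, ‖t‖ < r → ‖η‖ < ρ → ‖x‖ < ρ →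
        R ((t, η, 0), x) = 0 ∧
          HasFDerivAt R (0 : (ℂ × H × Ξ) × X →L[ℝ] E) ((t, η, 0), x)) ∧
      ∀ t η u x, ‖t‖ < r → ‖η‖ < ρ → ‖u‖ < ρ / r → ‖x‖ < ρ → t ≠ 0 →
        v ((η, t • u), x) =
          t • fderiv ℂ (fun ξ => v ((η, ξ), x)) 0 u + t ^ 2 • R ((t, η, u), x) := by
  set L : H → X → Ξ →L[ℂ] E := fun η x => fderiv ℂ (fun ξ => v ((η, ξ), x)) 0
  have hsu : ∀ (s : ℂ) (u : Ξ), ‖s‖ ≤ r → ‖u‖ < ρ / r → ‖s • u‖ < ρ := fun s u hs hu => by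
    rw [norm_smul]
    calc ‖s‖ * ‖u‖ ≤ r * ‖u‖ := by gcongr
      _ < r * (ρ / r) := by gcongr
      _ = ρ := mul_div_cancel₀ _ hr.ne'
  have hcirc : ∀ θ, ‖circleMap 0 r θ‖ = r := fun θ => by simp [abs_of_pos hr]
  set O : Set ((ℂ × H × Ξ) × X) :=
    {p | ‖p.1.1‖ < r ∧ ‖p.1.2.1‖ < ρ ∧ ‖p.1.2.2‖ < ρ / r ∧ ‖p.2‖ < ρ}
  have hO : IsOpen O := by
    have h1 : Continuous fun p : (ℂ × H × Ξ) × X => ‖p.1.1‖ := by fun_prop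
    have h2 : Continuous fun p : (ℂ × H × Ξ) × X => ‖p.1.2.1‖ := by fun_prop
    have h3 : Continuous fun p : (ℂ × H × Ξ) × X => ‖p.1.2.2‖ := by fun_prop
    have h4 : Continuous fun p : (ℂ × H × Ξ) × X => ‖p.2‖ := by fun_prop
    exact (isOpen_lt h1 continuous_const).inter ((isOpen_lt h2 continuous_const).inter
      ((isOpen_lt h3 continuous_const).inter (isOpen_lt h4 continuous_const)))
  set G : (ℂ × ℂ × H × Ξ) × X → E := fun p =>
    v ((p.1.2.2.1, p.1.1 • p.1.2.2.2), p.2) - p.1.1 • L p.1.2.2.1 p.2 p.1.2.2.2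
  set c : (ℂ × ℂ × H × Ξ) × X → ℂ := fun p => (p.1.1 ^ 2 * (p.1.1 - p.1.2.1))⁻¹
  set Ω : Set ((ℂ × ℂ × H × Ξ) × X) := {p | p.1.1 ≠ 0 ∧ p.1.1 ≠ p.1.2.1 ∧
    ((p.1.2.2.1, p.1.1 • p.1.2.2.2), p.2) ∈ Metric.ball (0 : (H × Ξ) × X) ρ}
  have hc : ContDiffHolOn μ c Ω := ContDiffHolOn.inv (ContDiffHolOn.contDiff_fst
    (g := fun q : ℂ × ℂ × H × Ξ => q.1 ^ 2 * (q.1 - q.2.1)) (by fun_prop) hμ)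
    fun p hp => mul_ne_zero (pow_ne_zero 2 hp.1) (sub_ne_zero.2 hp.2.1)
  have hG : ContDiffHolOn μ G Ω := by
    refine (hv.comp_contDiff_fst (g := fun q : ℂ × ℂ × H × Ξ => (q.2.2.1, q.1 • q.2.2.2)) hμ
      (by fun_prop) fun p hp => hp.2.2).sub ?_
    refine (ContDiffHolOn.contDiff_fst _root_.contDiff_fst hμ).smul ?_
    refine hL.comp_contDiff_fst (g := fun q : ℂ × ℂ × H × Ξ => q.2.2) hμ (by fun_prop) ?_
    rintro p ⟨-, -, hp⟩
    exact ⟨(mem_ball_zero_prod_prod.1 hp).1.1, (mem_ball_zero_prod_prod.1 hp).2⟩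
  have hΩ : ∀ p ∈ O, ∀ θ, ((circleMap 0 r θ, p.1), p.2) ∈ Ω := by
    rintro ⟨⟨t, η, u⟩, x⟩ ⟨ht, hη, hu, hx⟩ θ
    refine ⟨circleMap_ne_center hr.ne', ?_,
      mem_ball_zero_prod_prod.2 ⟨⟨hη, hsu _ _ (hcirc θ).le hu⟩, hx⟩⟩
    intro h
    change circleMap 0 r θ = t at h
    exact ht.ne (h ▸ hcirc θ)
  have hcG := hc.smul hG
  refine ⟨fun p => (2 * Real.pi * Complex.I : ℂ)⁻¹ • ∮ s in C(0, r),
    c ((s, p.1), p.2) • G ((s, p.1), p.2), (ContDiffHolOn.contDiff_fst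
      (g := fun _ => (2 * Real.pi * Complex.I : ℂ)⁻¹) contDiff_const hμ).smul
      (hcG.circleIntegral hμ hO hΩ), ?_, ?_⟩
  · intro t η x ht hη hx
    have hρ : 0 < ρ := (norm_nonneg _).trans_lt hη
    have hp : ((t, η, (0 : Ξ)), x) ∈ O := ⟨ht, hη, by rw [norm_zero]; positivity, hx⟩
    have hG0 : ∀ s, G ((s, t, η, 0), x) = 0 := fun s => by simpa [G] using hv0 η x hη hx
    refine ⟨by simp [hG0, _root_.circleIntegral], ?_⟩
    have key := hcG.hasFDerivAt_circleIntegral_zero hμ hO hΩ hp ?_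
    · have := key.const_smul (2 * Real.pi * Complex.I : ℂ)⁻¹
      rw [smul_zero] at this
      exact this
    intro θ
    set s := circleMap 0 r θ
    have hmem : ∀ᶠ p in 𝓝 ((t, η, (0 : Ξ)), x), ((s, p.1), p.2) ∈ Ω :=
      Filter.mem_of_superset (hO.mem_nhds hp) fun p hp => hΩ p hp θ
    have hμ' : (μ : WithTop ℕ∞) ≠ 0 := fun h => by
      have : (1 : WithTop ℕ∞) ≤ μ := by exact_mod_cast hμ
      simp [h] at this
    have hdiff : ∀ {F : Type} [NormedAddCommGroup F] [NormedSpace ℂ F]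
        {g : (ℂ × ℂ × H × Ξ) × X → F}, ContDiffHolOn μ g Ω → DifferentiableAt ℝ
        (fun p : (ℂ × H × Ξ) × X => g ((s, p.1), p.2)) ((t, η, 0), x) := by
      intro F _ _ g hg
      have h1 : DifferentiableOn ℝ (fun p : (ℂ × H × Ξ) × X => g ((s, p.1), p.2)) O :=
        (hg.1.differentiableOn hμ').comp (f := fun p : (ℂ × H × Ξ) × X => ((s, p.1), p.2))
          (by fun_prop) fun p hp => hΩ p hp θ
      exact h1.differentiableAt (hO.mem_nhds hp)
    have hG1 := (hdiff hG).hasFDerivAt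
    set T := fderiv ℝ (fun p : (ℂ × H × Ξ) × X => G ((s, p.1), p.2)) ((t, η, 0), x)
    have hline : ∀ w, ∀ᶠ τ in 𝓝 (0 : ℝ), ((t, η, (0 : Ξ)), x) + τ • w ∈ O := fun w => by
      have : Continuous fun τ : ℝ => ((t, η, (0 : Ξ)), x) + τ • w := by fun_prop
      exact this.continuousAt.preimage_mem_nhds (hO.mem_nhds (by simpa using hp))
    have hT1 : ∀ t' η' x', T ((t', η', 0), x') = 0 := by
      intro t' η' x'
      refine HasDerivAt.unique (hG1.hasLineDerivAt ((t', η', 0), x'))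
        ((hasDerivAt_const (0 : ℝ) (0 : E)).congr_of_eventuallyEq ?_)
      filter_upwards [hline ((t', η', 0), x')] with τ hτ
      have h1 := hv0 _ _ hτ.2.1 hτ.2.2.2
      simpa [G] using h1
    have hT2 : ∀ u', T ((0, 0, u'), 0) = 0 := by
      intro u'
      have h1 := (hv.hasDerivAt_smul hη hx (s • u')).sub
        ((hasDerivAt_id (0 : ℂ)).smul_const (s • L η x u'))
      have h2 : HasDerivAt (fun τ : ℝ => v ((η, (τ : ℂ) • s • u'), x) - (τ : ℂ) • s • L η x u')
          0 0 := by
        have h3 := (h1.hasFDerivAt.restrictScalars ℝ).comp_hasDerivAt_of_eq (0 : ℝ)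
          Complex.ofRealCLM.hasDerivAt (by simp)
        simpa [L, Function.comp_def] using h3
      refine HasDerivAt.unique (hG1.hasLineDerivAt ((0, 0, u'), 0)) ?_
      simpa [G, smul_comm s] using h2
    have hT : T = 0 := by
      refine ContinuousLinearMap.ext ?_
      rintro ⟨⟨t', η', u'⟩, x'⟩
      have : ((t', η', u'), x') = ((t', η', (0 : Ξ)), x') + ((0, 0, u'), 0) := by simp
      rw [this, map_add, hT1, hT2]
      simp
    rw [hT] at hG1
    have h5 := (hdiff hc).hasFDerivAt.smul hG1
    have h7 : c ((s, t, η, 0), x) •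
        (0 : (ℂ × H × Ξ) × X →L[ℝ] E) + (fderiv ℝ (fun p : (ℂ × H × Ξ) × X => c ((s, p.1), p.2))
          ((t, η, 0), x)).smulRight (G ((s, t, η, 0), x)) = 0 := by
      rw [hG0, smul_zero]
      simp
    exact h7 ▸ h5
  · intro t η u x ht hη hu hx ht0
    set g : ℂ → E := fun s => v ((η, s • u), x) - s • L η x u
    have hρ : 0 < ρ := (norm_nonneg _).trans_lt hη
    have hnhds : Metric.closedBall (0 : ℂ) r ∈ 𝓝 0 := Metric.closedBall_mem_nhds 0 hr
    have hg : DifferentiableOn ℂ g (Metric.closedBall 0 r) := by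
      refine DifferentiableOn.sub ?_ (by fun_prop)
      exact (hv.differentiableOn_snd hη hx).comp (f := fun s : ℂ => s • u) (by fun_prop)
        fun s hs => mem_ball_zero_iff.2 (hsu s u (mem_closedBall_zero_iff.1 hs) hu)
    have hg0 : g 0 = 0 := by simp [g, hv0 η x hη hx]
    have hg' : deriv g 0 = 0 := by
      have h1 := (hv.hasDerivAt_smul hη hx u).sub ((hasDerivAt_id (0 : ℂ)).smul_const (L η x u))
      rw [one_smul, sub_self] at h1
      exact h1.deriv
    have hf := (Complex.differentiableOn_dslope hnhds).2
      ((Complex.differentiableOn_dslope hnhds).2 hg)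
    have hfs : ∀ s ≠ 0, dslope (dslope g 0) 0 s = (s ^ 2)⁻¹ • g s := by
      intro s hs
      rw [dslope_of_ne _ hs, slope_def_module, dslope_same, hg', dslope_of_ne _ hs,
        slope_def_module, hg0]
      simp [smul_smul, sq]
    have hC := (hf.diffContOnCl_ball subset_rfl).two_pi_i_inv_smul_circleIntegral_sub_inv_smul
      (mem_ball_zero_iff.2 ht)
    rw [hfs t ht0] at hC
    have hI : (∮ s in C(0, r), (s - t)⁻¹ • dslope (dslope g 0) 0 s) =
        ∮ s in C(0, r), c ((s, t, η, u), x) • G ((s, t, η, u), x) := by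
      refine circleIntegral.integral_congr hr.le fun s hs => ?_
      have hs0 : s ≠ 0 := by
        rintro rfl
        simp [hr.ne] at hs
      simp only [hfs s hs0, c, G, g, smul_smul, mul_inv]
      rw [mul_comm]
    rw [hI] at hC
    change _ = t • L η x u + t ^ 2 • ((2 * Real.pi * Complex.I : ℂ)⁻¹ • ∮ s in C(0, r),
      c ((s, t, η, u), x) • G ((s, t, η, u), x))
    rw [hC, smul_inv_smul₀ (pow_ne_zero 2 ht0)]
    simp [g]

end Remainder

theorem contDiff_matrix_det {𝕜 ι : Type*} [NontriviallyNormedField 𝕜] [Fintype ι] [DecidableEq ι]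
    {n : WithTop ℕ∞} : ContDiff 𝕜 n fun M : ι → ι → 𝕜 => (Matrix.of M).det := by
  simp only [Matrix.det_apply, Matrix.of_apply]
  refine ContDiff.sum fun σ _ => ContDiff.const_smul _ (contDiff_prod fun i _ => ?_)
  fun_prop

theorem contDiff_matrix_mulVec {𝕜 ι κ : Type*} [NontriviallyNormedField 𝕜] [Fintype ι] [Fintype κ]
    {n : WithTop ℕ∞} :
    ContDiff 𝕜 n fun p : (ι → κ → 𝕜) × (κ → 𝕜) => Matrix.mulVec (Matrix.of p.1) p.2 := by
  refine contDiff_pi.2 fun i => ?_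
  simp only [Matrix.mulVec, dotProduct, Matrix.of_apply]
  fun_prop

theorem contDiff_matrix_adjugate {𝕜 ι : Type*} [NontriviallyNormedField 𝕜] [Fintype ι]
    [DecidableEq ι] {n : WithTop ℕ∞} :
    ContDiff 𝕜 n fun M : ι → ι → 𝕜 => (fun i j => (Matrix.of M).adjugate i j : ι → ι → 𝕜) := by
  refine contDiff_pi.2 fun i => contDiff_pi.2 fun j => ?_
  simp only [Matrix.adjugate_apply]
  refine contDiff_matrix_det.comp
    (f := fun M : ι → ι → 𝕜 => fun k l => (Matrix.of M).updateRow j (Pi.single i 1) k l) ?_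
  refine contDiff_pi.2 fun k => contDiff_pi.2 fun l => ?_
  simp only [Matrix.updateRow_apply, Matrix.of_apply]
  split_ifs <;> fun_prop

theorem ContinuousLinearMap.eq_matrix_mulVec {𝕜 ι κ : Type*} [NontriviallyNormedField 𝕜]
    [Fintype κ] [DecidableEq κ] (L : (κ → 𝕜) →L[𝕜] (ι → 𝕜)) (u : κ → 𝕜) :
    L u = Matrix.mulVec (Matrix.of fun i j => L (Pi.single j 1) i) u := by
  refine (LinearMap.toMatrix'_mulVec L.toLinearMap u).symm.trans ?_
  congr 1

/-- Singular implicit function theorem: `B` inverts `∂v/∂ξ` at `ξ = 0` up to the scalar `d`, and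
`v ((η, ·), x) = d (η, x) ^ 2 • z` is solved for small `z` even where `d` vanishes. -/
theorem ContDiffHolOn.exists_singular_implicit {H Ξ X E : Type}
    [NormedAddCommGroup H] [NormedSpace ℂ H] [FiniteDimensional ℂ H]
    [NormedAddCommGroup Ξ] [NormedSpace ℂ Ξ] [NormedAddCommGroup E] [NormedSpace ℂ E]
    [FiniteDimensional ℂ E] [NormedAddCommGroup X] [NormedSpace ℝ X] [CompleteSpace X]
    {μ : ℕ∞} (hμ : 1 ≤ μ) {ρ : ℝ} (hρ : 0 < ρ) {v : (H × Ξ) × X → E}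
    (hv : ContDiffHolOn μ v (Metric.ball 0 ρ))
    (hv0 : ∀ η x, ‖η‖ < ρ → ‖x‖ < ρ → v ((η, 0), x) = 0)
    (hL : ContDiffHolOn μ
      (fun p : (H × Ξ) × X => fderiv ℂ (fun ξ => v ((p.1.1, ξ), p.2)) 0 p.1.2)
      {p | ‖p.1.1‖ < ρ ∧ ‖p.2‖ < ρ})
    {d : H × X → ℂ} (hd : ContDiffHolOn μ d (Metric.ball 0 ρ)) {B : (H × E) × X → Ξ}
    (hB : ContDiffHolOn μ B {p | ‖p.1.1‖ < ρ ∧ ‖p.2‖ < ρ}) (hB0 : B 0 = 0)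
    (hdB : ∀ η w x, fderiv ℂ (fun ξ => v ((η, ξ), x)) 0 (B ((η, w), x)) = d (η, x) • w) :
    ∃ W : Set ((H × E) × X), IsOpen W ∧ 0 ∈ W ∧ ∃ φ : (H × E) × X → Ξ, ContDiffHolOn μ φ W ∧
      ∀ p ∈ W, v ((p.1.1, φ p), p.2) = d (p.1.1, p.2) ^ 2 • p.1.2 := by
  have hE : CompleteSpace E := FiniteDimensional.complete ℂ E
  have hμ' : (μ : WithTop ℕ∞) ≠ 0 := fun h => by
    have : (1 : WithTop ℕ∞) ≤ μ := by exact_mod_cast hμ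
    simp [h] at this
  set O₁ : Set ((H × E) × X) := {p | ‖p.1.1‖ < ρ ∧ ‖p.2‖ < ρ}
  have hO₁ : IsOpen O₁ := by
    have h1 : Continuous fun p : (H × E) × X => ‖p.1.1‖ := by fun_prop
    have h2 : Continuous fun p : (H × E) × X => ‖p.2‖ := by fun_prop
    exact (isOpen_lt h1 continuous_const).inter (isOpen_lt h2 continuous_const)
  have hd₁ : ContDiffHolOn μ (fun p => d (p.1.1, p.2)) O₁ :=
    hd.comp_contDiff_fst hμ _root_.contDiff_fst fun p hp => mem_ball_zero_prod.2 hp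
  set r : ℝ := ‖d 0‖ + 1
  have hr : 0 < r := by positivity
  obtain ⟨R, hR, hR0, hRv⟩ := hv.exists_remainder hμ hv0 hL hr
  set O : Set ((H × E) × X) :=
    O₁ ∩ (fun p => (‖d (p.1.1, p.2)‖, ‖B p‖)) ⁻¹' (Set.Iio r ×ˢ Set.Iio (ρ / r))
  have hO : IsOpen O := (hd₁.1.continuousOn.norm.prodMk
    hB.1.continuousOn.norm).isOpen_inter_preimage hO₁ (isOpen_Iio.prod isOpen_Iio)
  have h0 : (0 : (H × E) × X) ∈ O := by
    refine ⟨⟨by simpa using hρ, by simpa using hρ⟩, lt_add_one ‖d 0‖, ?_⟩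
    change ‖B 0‖ < ρ / r
    rw [hB0, norm_zero]
    positivity
  set g : (H × E) × X → ℂ × H × Ξ := fun p => (d (p.1.1, p.2), p.1.1, B p)
  have hg : ContDiffHolOn μ g O := (hd₁.mono Set.inter_subset_left).prodMk
    ((ContDiffHolOn.contDiff_fst _root_.contDiff_fst hμ).prodMk (hB.mono Set.inter_subset_left))
  set F : (H × E) × X → E := fun p => R (g p, p.2)
  have hF : ContDiffHolOn μ F O := hR.comp hg fun p hp => ⟨hp.2.1, hp.1.1, hp.2.2, hp.1.2⟩
  have hΨ : ContDiffHolOn μ (fun p => (p.1.1, p.1.2 + F p)) O :=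
    (ContDiffHolOn.contDiff_fst _root_.contDiff_fst hμ).prodMk
      ((ContDiffHolOn.contDiff_fst _root_.contDiff_snd hμ).add hF)
  have hg0 : (g 0, (0 : X)) = ((d 0, 0, 0), 0) := by
    simp only [g, hB0]
    rfl
  obtain ⟨hR0', hRd⟩ := hR0 (d 0) 0 0 (lt_add_one _) (by simpa using hρ) (by simpa using hρ)
  rw [← hg0] at hR0' hRd
  have hFd : HasFDerivAt F (0 : (H × E) × X →L[ℝ] E) 0 := by
    have h1 : DifferentiableAt ℝ (fun p : (H × E) × X => (g p, p.2)) 0 :=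
      ((hg.1.differentiableOn hμ').differentiableAt (hO.mem_nhds h0)).prodMk differentiableAt_snd
    have h2 := HasFDerivAt.comp (f := fun p : (H × E) × X => (g p, p.2)) 0 hRd h1.hasFDerivAt
    rw [ContinuousLinearMap.zero_comp] at h2
    exact h2
  have hΨd : HasFDerivAt (fun p : (H × E) × X => (p.1.1, p.1.2 + F p))
      (ContinuousLinearMap.fst ℝ (H × E) X) 0 := by
    have h1 : HasFDerivAt (fun p : (H × E) × X => p.1)
      (ContinuousLinearMap.fst ℝ (H × E) X) 0 := hasFDerivAt_fst
    have h2 := h1.fst.prodMk (h1.snd.add hFd)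
    rw [add_zero] at h2
    exact h2
  obtain ⟨W, hW, hW0, S, hS, hSW⟩ := hΨ.exists_local_inverse hμ hO h0 hΨd
  refine ⟨W, hW, ?_, fun p => d ((S p).1, p.2) • B (S p, p.2),
    (hd₁.smul hB).comp hS fun p hp => (hSW p hp).1.1, fun p hp => ?_⟩
  · have : F 0 = 0 := hR0'
    simp only [this, Prod.fst_zero, Prod.snd_zero, add_zero] at hW0
    exact hW0
  obtain ⟨⟨⟨hη, hx⟩, hdr, hBr⟩, hSp⟩ := hSW p hp
  obtain ⟨h1, h2⟩ := Prod.ext_iff.1 hSp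
  simp only at h1 h2
  rw [← h1, ← h2]
  by_cases hd0 : d ((S p).1, p.2) = 0
  · simp [hd0, hv0 _ _ hη hx]
  · rw [hRv _ _ _ _ hdr hη hBr hx hd0, hdB, smul_smul, ← sq, ← smul_add]

/-- The matrix of `fderiv ℂ (fun ξ => v ((η, ξ), x)) 0` in the standard basis. -/
noncomputable def sndJacobian {H X ι : Type*} [Fintype ι] [DecidableEq ι]
    (v : (H × (ι → ℂ)) × X → ι → ℂ) (p : H × X) : ι → ι → ℂ :=
  fun i j => fderiv ℂ (fun ξ => v ((p.1, ξ), p.2)) 0 (Pi.single j 1) i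

theorem ContDiffHolOn.exists_singular_implicit_det {H X ι : Type} [Fintype ι] [DecidableEq ι]
    [NormedAddCommGroup H] [NormedSpace ℂ H] [FiniteDimensional ℂ H]
    [NormedAddCommGroup X] [NormedSpace ℝ X] [CompleteSpace X] {μ : ℕ∞} (hμ : 1 ≤ μ) {ρ : ℝ}
    (hρ : 0 < ρ) {v : (H × (ι → ℂ)) × X → ι → ℂ} (hv : ContDiffHolOn μ v (Metric.ball 0 ρ))
    (hv0 : ∀ η x, ‖η‖ < ρ → ‖x‖ < ρ → v ((η, 0), x) = 0) :
    ∃ W : Set ((H × (ι → ℂ)) × X), IsOpen W ∧ 0 ∈ W ∧ ∃ φ : (H × (ι → ℂ)) × X → ι → ℂ,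
      ContDiffHolOn μ φ W ∧ ∀ p ∈ W, v ((p.1.1, φ p), p.2) =
        (Matrix.of (sndJacobian v (p.1.1, p.2))).det ^ 2 • p.1.2 := by
  have hA : ContDiffHolOn μ (sndJacobian v) (Metric.ball 0 ρ) :=
    .pi fun i => .pi fun j => (hv.fderiv_snd_apply hμ (Pi.single j 1)).contDiff_comp
      (contDiff_apply ℂ ℂ i) hμ
  have hLA : ∀ η x u, fderiv ℂ (fun ξ => v ((η, ξ), x)) 0 u =
      Matrix.mulVec (Matrix.of (sndJacobian v (η, x))) u := fun η x u =>
    ContinuousLinearMap.eq_matrix_mulVec _ u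
  have hA₁ : ContDiffHolOn μ (fun p : (H × (ι → ℂ)) × X => sndJacobian v (p.1.1, p.2))
      {p | ‖p.1.1‖ < ρ ∧ ‖p.2‖ < ρ} :=
    hA.comp_contDiff_fst hμ _root_.contDiff_fst fun p hp => mem_ball_zero_prod.2 hp
  have hsnd : ContDiffHolOn μ (fun p : (H × (ι → ℂ)) × X => p.1.2)
      {p | ‖p.1.1‖ < ρ ∧ ‖p.2‖ < ρ} := .contDiff_fst _root_.contDiff_snd hμ
  have hadj : ContDiffHolOn μ (fun p : (H × (ι → ℂ)) × X => (fun i j =>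
      (Matrix.of (sndJacobian v (p.1.1, p.2))).adjugate i j : ι → ι → ℂ))
      {p | ‖p.1.1‖ < ρ ∧ ‖p.2‖ < ρ} := contDiff_comp (g := fun M : ι → ι → ℂ => (fun i j =>
        (Matrix.of M).adjugate i j : ι → ι → ℂ)) contDiff_matrix_adjugate hμ hA₁
  have hdet : ContDiffHolOn μ (fun p => (Matrix.of (sndJacobian v p)).det) (Metric.ball 0 ρ) :=
    contDiff_comp (g := fun M : ι → ι → ℂ => (Matrix.of M).det) contDiff_matrix_det hμ hA
  have hmul : ContDiff ℂ μ fun p : (ι → ι → ℂ) × (ι → ℂ) => Matrix.mulVec (Matrix.of p.1) p.2 :=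
    contDiff_matrix_mulVec
  have hL : ContDiffHolOn μ
      (fun p : (H × (ι → ℂ)) × X => fderiv ℂ (fun ξ => v ((p.1.1, ξ), p.2)) 0 p.1.2)
      {p | ‖p.1.1‖ < ρ ∧ ‖p.2‖ < ρ} :=
    (contDiff_comp hmul hμ (hA₁.prodMk hsnd)).congr fun p _ => hLA _ _ _
  have hB : ContDiffHolOn μ (fun p : (H × (ι → ℂ)) × X =>
      Matrix.mulVec (Matrix.of (sndJacobian v (p.1.1, p.2))).adjugate p.1.2)
      {p | ‖p.1.1‖ < ρ ∧ ‖p.2‖ < ρ} :=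
    (contDiff_comp hmul hμ (hadj.prodMk hsnd)).congr fun p _ => rfl
  have hB0 : Matrix.mulVec (Matrix.of (sndJacobian v ((0 : H), (0 : X)))).adjugate 0 = 0 :=
    Matrix.mulVec_zero _
  have hdB : ∀ η w x, fderiv ℂ (fun ξ => v ((η, ξ), x)) 0
      (Matrix.mulVec (Matrix.of (sndJacobian v (η, x))).adjugate w) =
        (Matrix.of (sndJacobian v (η, x))).det • w := fun η w x => by
    rw [hLA, Matrix.mulVec_mulVec, Matrix.mul_adjugate, Matrix.smul_mulVec, Matrix.one_mulVec]
  have key := hv.exists_singular_implicit hμ hρ hv0 hL hdet hB hB0 hdB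
  exact key

/-- Lemma 3.3 of Kim–Zaitsev: if `V(η, ξ; x)` is `C^μ`, holomorphic in `(η, ξ)` for fixed
`x`, with `V(η, 0; x) ≡ 0` and `δ(η; x) := (det ∂V/∂ξ(η, 0; x))²` not vanishing
identically in `η` for each fixed `x`, then there is a map `φ(η, Z̃; x)` of class `C^μ`,
holomorphic in `(η, Z̃)` for fixed `x`, with
`V(η, φ(η, Z/δ(η; x); x); x) = Z` whenever `(η; x)` is sufficiently small,
`δ(η; x) ≠ 0` and `Z/δ(η; x)` is sufficiently small. -/
theorem singular_implicit_solution {h N m : ℕ} (μ : ℕ∞) (hμ : 1 ≤ μ)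
    (U : Set ((Fin h → ℂ) × (Fin N → ℂ) × (Fin m → ℝ))) (hU : IsOpen U)
    (hU0 : (0 : (Fin h → ℂ) × (Fin N → ℂ) × (Fin m → ℝ)) ∈ U)
    (V : ((Fin h → ℂ) × (Fin N → ℂ) × (Fin m → ℝ)) → (Fin N → ℂ))
    (hVsmooth : ContDiffOn ℝ μ V U)
    (hVhol : ∀ x : Fin m → ℝ,
      DifferentiableOn ℂ (fun p : (Fin h → ℂ) × (Fin N → ℂ) => V (p.1, p.2, x))
        {p : (Fin h → ℂ) × (Fin N → ℂ) | (p.1, p.2, x) ∈ U})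
    (hV0 : ∀ (η : Fin h → ℂ) (x : Fin m → ℝ), (η, (0 : Fin N → ℂ), x) ∈ U → V (η, 0, x) = 0)
    (δ : (Fin h → ℂ) → (Fin m → ℝ) → ℂ)
    (hδ : ∀ η x, δ η x =
      (Matrix.det (Matrix.of fun i j =>
        fderiv ℂ (fun ξ : Fin N → ℂ => V (η, ξ, x)) 0 (Pi.single j 1) i)) ^ 2)
    (hδnv : ∀ x : Fin m → ℝ, (∃ η : Fin h → ℂ, (η, (0 : Fin N → ℂ), x) ∈ U) →
      ∃ η : Fin h → ℂ, (η, (0 : Fin N → ℂ), x) ∈ U ∧ δ η x ≠ 0) :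
    ∃ W : Set ((Fin h → ℂ) × (Fin N → ℂ) × (Fin m → ℝ)), IsOpen W ∧
      (0 : (Fin h → ℂ) × (Fin N → ℂ) × (Fin m → ℝ)) ∈ W ∧
    ∃ φ : ((Fin h → ℂ) × (Fin N → ℂ) × (Fin m → ℝ)) → (Fin N → ℂ),
      ContDiffOn ℝ μ φ W ∧
      (∀ x : Fin m → ℝ,
        DifferentiableOn ℂ (fun p : (Fin h → ℂ) × (Fin N → ℂ) => φ (p.1, p.2, x))
          {p : (Fin h → ℂ) × (Fin N → ℂ) | (p.1, p.2, x) ∈ W}) ∧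
      ∃ ε₁ > (0 : ℝ), ∃ ε₂ > (0 : ℝ),
        ∀ (η : Fin h → ℂ) (x : Fin m → ℝ) (Z : Fin N → ℂ),
          ‖η‖ < ε₁ → ‖x‖ < ε₁ → δ η x ≠ 0 → ‖(δ η x)⁻¹ • Z‖ < ε₂ →
            V (η, φ (η, (δ η x)⁻¹ • Z, x), x) = Z := by
  have he : Continuous fun p : ((Fin h → ℂ) × (Fin N → ℂ)) × (Fin m → ℝ) =>
      (p.1.1, p.1.2, p.2) := by fun_prop
  have he' : Continuous fun p : (Fin h → ℂ) × (Fin N → ℂ) × (Fin m → ℝ) =>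
      ((p.1, p.2.1), p.2.2) := by fun_prop
  obtain ⟨ρ, hρ, hρU⟩ := Metric.isOpen_iff.1 (hU.preimage he) 0 hU0
  have hv : ContDiffHolOn μ (fun p : ((Fin h → ℂ) × (Fin N → ℂ)) × (Fin m → ℝ) =>
      V (p.1.1, p.1.2, p.2)) (Metric.ball 0 ρ) :=
    ⟨hVsmooth.comp (f := fun p : ((Fin h → ℂ) × (Fin N → ℂ)) × (Fin m → ℝ) =>
      (p.1.1, p.1.2, p.2)) (ContDiff.contDiffOn (by fun_prop)) hρU,
      fun x => (hVhol x).mono fun _ hq => hρU hq⟩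
  obtain ⟨W, hW, hW0, φ, hφ, hφW⟩ := hv.exists_singular_implicit_det hμ hρ fun η x hη hx =>
    hV0 η x (hρU (mem_ball_zero_prod_prod.2 ⟨⟨hη, by simpa using hρ⟩, hx⟩))
  obtain ⟨ε, hε, hεW⟩ := Metric.isOpen_iff.1 hW 0 hW0
  refine ⟨_, hW.preimage he', hW0, fun p => φ ((p.1, p.2.1), p.2.2),
    hφ.1.comp (f := fun p : (Fin h → ℂ) × (Fin N → ℂ) × (Fin m → ℝ) => ((p.1, p.2.1), p.2.2))
      (ContDiff.contDiffOn (by fun_prop)) fun _ hp => hp, hφ.2, ε, hε, ε, hε, ?_⟩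
  intro η x Z hη hx hδ0 hZ
  have h1 := hφW ((η, (δ η x)⁻¹ • Z), x)
    (hεW (mem_ball_zero_prod_prod.2 ⟨⟨hη, hZ⟩, hx⟩))
  refine h1.trans ?_
  change (Matrix.det (Matrix.of fun i j =>
    fderiv ℂ (fun ξ : Fin N → ℂ => V (η, ξ, x)) 0 (Pi.single j 1) i)) ^ 2 • (δ η x)⁻¹ • Z = Z
  rw [← hδ, smul_inv_smul₀ hδ0]
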